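/- Fix n ≥ 0. Then ω^{(m)}(ζ) ∈ K_n(ζ) for every 0 ≤ m ≤ n. Moreover: (a) if a ∈ A is coprime to 𝔭 and σ is a field automorphism of K_n(ζ) fixing K(ζ) pointwise such that σ(x) = 𝔠_a(x) for every x ∈ C[𝔭^{n+1}], then σ(ω^{(n)}(ζ)) = ∑_{j=0}^n a_t^{(j)}(ζ)·ω^{(n−j)}(ζ); (b) if F is a field automorphism of K_n(ζ) fixing K and C[𝔭^{n+1}] pointwise with F(ζ) = ζ^q, then F(ω^{(n)}(ζ_i)) = ω^{(n)}(ζ_{i+1}) for all i = 1,…,d−1. -/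

import Mathlib

open Polynomial Filter Topology

lemma hasSum_congr {ι M : Type*} [AddCommMonoid M] [TopologicalSpace M] {f g : ι → M} {a : M}
    (h : ∀ i, f i = g i) : HasSum f a ↔ HasSum g a := by
  rw [funext h]

section Norm

variable {𝔽 L : Type*} [Field 𝔽] [Fintype 𝔽] [NormedField L] [Algebra 𝔽 L]

/-- Elements algebraic over a finite field have norm at most one. -/
lemma norm_le_one_of_isAlgebraic_finite {x : L} (hx : IsAlgebraic 𝔽 x) : ‖x‖ ≤ 1 := by
  have := IntermediateField.adjoin.finiteDimensional hx.isIntegral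
  have : Finite (IntermediateField.adjoin 𝔽 {x}) := Module.finite_of_finite 𝔽
  have := Fintype.ofFinite (IntermediateField.adjoin 𝔽 {x})
  have h := congrArg (algebraMap _ L)
    (FiniteField.pow_card (IntermediateField.AdjoinSimple.gen 𝔽 x))
  rw [map_pow, IntermediateField.AdjoinSimple.algebraMap_gen] at h
  by_contra! hlt
  have h1 := congrArg norm h
  rw [norm_pow] at h1
  exact ((lt_self_pow₀ hlt Fintype.one_lt_card).ne' h1)

lemma norm_algebraMap_le_one (s : 𝔽) : ‖algebraMap 𝔽 L s‖ ≤ 1 :=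
  norm_le_one_of_isAlgebraic_finite (isAlgebraic_algebraMap (A := L) s)

variable [IsUltrametricDist L] [CompleteSpace L]

lemma summable_algebraMap_mul {w : ℕ → L} (hw : Tendsto (fun i => ‖w i‖) atTop (𝓝 0))
    (s : ℕ → 𝔽) : Summable fun i => algebraMap 𝔽 L (s i) * w i := by
  refine NonarchimedeanAddGroup.summable_of_tendsto_cofinite_zero ?_
  rw [Nat.cofinite_eq_atTop]
  refine squeeze_zero_norm (fun i => ?_) hw
  rw [norm_mul]
  exact mul_le_of_le_one_left (norm_nonneg _) (norm_algebraMap_le_one _)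

end Norm

/-- A power series vanishing on the closed unit disc has zero coefficients. -/
lemma coeff_eq_zero_of_hasSum_zero {L : Type*} [NormedField L] [IsUltrametricDist L]
    {θ : L} (hθ : 1 < ‖θ‖) {c : ℕ → L}
    (hc : ∀ z : L, ‖z‖ ≤ 1 → HasSum (fun i => c i * z ^ i) 0) (m : ℕ) : c m = 0 := by
  induction m using Nat.strong_induction_on with
  | _ m ih =>
  have hb : ∃ M, ∀ i, ‖c i‖ ≤ M := by
    have h := (hc 1 (by simp)).summable.tendsto_atTop_zero
    simp only [one_pow, mul_one] at h
    obtain ⟨M, hM⟩ := h.norm.bddAbove_range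
    exact ⟨M, fun i => hM ⟨i, rfl⟩⟩
  obtain ⟨M, hM⟩ := hb
  have hM0 : 0 ≤ M := (norm_nonneg _).trans (hM 0)
  have key : ∀ z : L, z ≠ 0 → ‖z‖ ≤ 1 → ‖c m‖ ≤ M * ‖z‖ := by
    intro z hz hz1
    have h1 : HasSum (fun i => c (i + (m + 1)) * z ^ (i + (m + 1))) (-(c m * z ^ m)) := by
      have := (hasSum_nat_add_iff' (m + 1)).2 (hc z hz1)
      rwa [Finset.sum_range_succ, Finset.sum_eq_zero, zero_add, zero_sub] at this
      intro i hi
      rw [ih i (Finset.mem_range.1 hi), zero_mul]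
    have h2 := IsUltrametricDist.norm_tsum_le_of_forall_le_of_nonneg
      (f := fun i => c (i + (m + 1)) * z ^ (i + (m + 1))) (C := M * ‖z‖ ^ (m + 1))
      (by positivity) fun i => by
        rw [norm_mul, norm_pow]
        exact mul_le_mul (hM _) (pow_le_pow_of_le_one (norm_nonneg _) hz1 (by omega))
          (by positivity) hM0
    rw [h1.tsum_eq, norm_neg, norm_mul, norm_pow, pow_succ', ← mul_assoc] at h2
    exact le_of_mul_le_mul_right h2 (pow_pos (norm_pos_iff.2 hz) _)
  have hθ0 : θ ≠ 0 := norm_pos_iff.1 (one_pos.trans hθ)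
  have hlim : Tendsto (fun k : ℕ => M * ‖θ⁻¹ ^ k‖) atTop (𝓝 (M * 0)) := by
    refine Tendsto.const_mul _ ?_
    simp only [norm_pow]
    exact tendsto_pow_atTop_nhds_zero_of_lt_one (norm_nonneg _)
      (by rw [norm_inv]; exact inv_lt_one_of_one_lt₀ hθ)
  rw [mul_zero] at hlim
  refine norm_le_zero_iff.1 (ge_of_tendsto' hlim fun k => key _ (by positivity) ?_)
  rw [norm_pow, norm_inv]
  exact pow_le_one₀ (by positivity) (inv_le_one_of_one_le₀ hθ.le)

section AndersonThakur

variable {𝔽 L : Type*} [Field 𝔽] [Fintype 𝔽] [NormedField L] [Algebra 𝔽 L]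

lemma hasSum_pow_card {ι : Type*} {f : ι → L} {S : L} (h : HasSum f S) :
    HasSum (fun i => f i ^ Fintype.card 𝔽) (S ^ Fintype.card 𝔽) :=
  h.map (FiniteField.frobeniusAlgHom 𝔽 L) (continuous_pow _)

lemma hasProd_pow {ι : Type*} {f : ι → L} {P : L} (h : HasProd f P) (q : ℕ) :
    HasProd (fun i => f i ^ q) (P ^ q) :=
  h.map (powMonoidHom q) (continuous_pow _)

/-- The functional equation `ω^{(1)} = (t - θ) ω` read on coefficients: the `i`-th coefficient of
`ω` is sent to the previous one by `𝔠_θ`. -/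
lemma andersonThakur_coeff [IsAlgClosed L] [IsUltrametricDist L] {θ lam : L} (hθ : 1 < ‖θ‖)
    (hlam : lam ^ (Fintype.card 𝔽 - 1) = -θ) {w : ℕ → L}
    (hω : ∀ z : L, ‖z‖ ≤ 1 → ∃ P : L,
      HasProd (fun j : ℕ => (1 - z / θ ^ Fintype.card 𝔽 ^ j)⁻¹) P ∧
      HasSum (fun i : ℕ => w i * z ^ i) (lam * P)) (i : ℕ) :
    w i ^ Fintype.card 𝔽 + θ * w i = if i = 0 then 0 else w (i - 1) := by
  set q := Fintype.card 𝔽 with hq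
  have hq0 : q ≠ 0 := Fintype.card_ne_zero
  have hθ0 : θ ≠ 0 := norm_pos_iff.1 (one_pos.trans hθ)
  refine sub_eq_zero.1 (coeff_eq_zero_of_hasSum_zero hθ
    (c := fun i => w i ^ q + θ * w i - if i = 0 then 0 else w (i - 1)) (fun y hy => ?_) i)
  obtain ⟨z, rfl⟩ := IsAlgClosed.exists_pow_nat_eq y (Nat.pos_of_ne_zero hq0)
  have hz : ‖z‖ ≤ 1 := by
    rw [norm_pow] at hy
    exact (pow_le_one_iff_of_nonneg (norm_nonneg _) hq0).1 hy
  obtain ⟨P, hP, hwP⟩ := hω z hz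
  obtain ⟨P', hP', hwP'⟩ := hω (z ^ q) hy
  have hPP : P' = (1 - z ^ q / θ)⁻¹ * P ^ q := by
    have h1 : HasProd (fun j : ℕ => (1 - z ^ q / θ ^ q ^ (j + 1))⁻¹) (P ^ q) := by
      convert hasProd_pow hP q using 2 with j
      have := map_sub (FiniteField.frobeniusAlgHom 𝔽 L) 1 (z / θ ^ q ^ j)
      simp only [FiniteField.frobeniusAlgHom_apply, ← hq] at this
      rw [inv_pow, this, one_pow, div_pow, ← pow_mul, pow_succ]
    have h2 := h1.zero_mul (f := fun j : ℕ => (1 - z ^ q / θ ^ q ^ j)⁻¹)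
    simp only [pow_zero, pow_one] at h2
    exact hP'.unique h2
  have hne : 1 - z ^ q / θ ≠ 0 := by
    intro h
    rw [sub_eq_zero, eq_div_iff hθ0, one_mul] at h
    rw [← h] at hy
    exact absurd hy hθ.not_ge
  have hS : (lam * P) ^ q = (z ^ q - θ) * (lam * P') := by
    have hl : lam ^ q = -θ * lam := by
      rw [← hlam, ← pow_succ, Nat.sub_add_cancel (Nat.pos_of_ne_zero hq0)]
    have hPq : P ^ q = (1 - z ^ q / θ) * P' := by
      rw [hPP, mul_inv_cancel_left₀ hne]
    rw [mul_pow, hl, hPq]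
    field_simp
    ring
  have hA := hasSum_pow_card (𝔽 := 𝔽) hwP
  rw [← hq, hS] at hA
  have hB : HasSum (fun i => (if i = 0 then 0 else w (i - 1)) * (z ^ q) ^ i)
      (z ^ q * (lam * P')) := by
    have h := (hasSum_nat_add_iff
      (f := fun i => (if i = 0 then 0 else w (i - 1)) * (z ^ q) ^ i)
      (g := z ^ q * (lam * P')) 1).1 ?_
    · simpa using h
    · refine (hasSum_congr fun i => ?_).1 (hwP'.mul_left (z ^ q))
      simp only [Nat.add_eq_zero_iff, one_ne_zero, and_false, if_false, Nat.add_sub_cancel]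
      ring
  have hC := (hA.add (hwP'.mul_left θ)).sub hB
  rw [show (z ^ q - θ) * (lam * P') + θ * (lam * P') - z ^ q * (lam * P') = 0 by ring] at hC
  refine (hasSum_congr fun i => ?_).1 hC
  rw [mul_pow, ← pow_mul, ← pow_mul, mul_comm i q]
  ring

/-- Pairing the coefficients of `ω` with a linear functional on `𝔽[X]` intertwines the Carlitz
action of `a` with multiplication by `a`. -/
lemma hasSum_carlitz {θ : L} {𝔠 : 𝔽[X] → L → L}
    (hc_add : ∀ a b : 𝔽[X], ∀ x : L, 𝔠 (a + b) x = 𝔠 a x + 𝔠 b x)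
    (hc_mul : ∀ a b : 𝔽[X], ∀ x : L, 𝔠 (a * b) x = 𝔠 a (𝔠 b x))
    (hc_C : ∀ (s : 𝔽) (x : L), 𝔠 (C s) x = algebraMap 𝔽 L s * x)
    (hc_X : ∀ x : L, 𝔠 X x = x ^ Fintype.card 𝔽 + θ * x)
    {w : ℕ → L}
    (hw : ∀ i, w i ^ Fintype.card 𝔽 + θ * w i = if i = 0 then 0 else w (i - 1))
    (a : 𝔽[X]) (l : 𝔽[X] →ₗ[𝔽] 𝔽) {S : L}
    (hS : HasSum (fun i => algebraMap 𝔽 L (l (X ^ i)) * w i) S) :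
    HasSum (fun i => algebraMap 𝔽 L (l (a * X ^ i)) * w i) (𝔠 a S) := by
  have hmul : ∀ a b : 𝔽[X],
      (∀ (l : 𝔽[X] →ₗ[𝔽] 𝔽) (S : L),
        HasSum (fun i => algebraMap 𝔽 L (l (X ^ i)) * w i) S →
        HasSum (fun i => algebraMap 𝔽 L (l (a * X ^ i)) * w i) (𝔠 a S)) →
      (∀ (l : 𝔽[X] →ₗ[𝔽] 𝔽) (S : L),
        HasSum (fun i => algebraMap 𝔽 L (l (X ^ i)) * w i) S →
        HasSum (fun i => algebraMap 𝔽 L (l (b * X ^ i)) * w i) (𝔠 b S)) →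
      ∀ (l : 𝔽[X] →ₗ[𝔽] 𝔽) (S : L),
        HasSum (fun i => algebraMap 𝔽 L (l (X ^ i)) * w i) S →
        HasSum (fun i => algebraMap 𝔽 L (l (a * b * X ^ i)) * w i) (𝔠 (a * b) S) := by
    intro a b ha hb l S hS
    rw [hc_mul]
    have := ha (l ∘ₗ LinearMap.mulLeft 𝔽 b) (𝔠 b S) (by simpa using hb l S hS)
    refine (hasSum_congr fun i => ?_).1 this
    rw [LinearMap.comp_apply, LinearMap.mulLeft_apply, mul_left_comm, mul_assoc]
  have hC : ∀ (s : 𝔽) (l : 𝔽[X] →ₗ[𝔽] 𝔽) (S : L),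
      HasSum (fun i => algebraMap 𝔽 L (l (X ^ i)) * w i) S →
      HasSum (fun i => algebraMap 𝔽 L (l (C s * X ^ i)) * w i) (𝔠 (C s) S) := by
    intro s l S hS
    rw [hc_C]
    refine (hasSum_congr fun i => ?_).2 (hS.mul_left (algebraMap 𝔽 L s))
    rw [← smul_eq_C_mul, map_smul, smul_eq_mul, map_mul, mul_assoc]
  have hX : ∀ (l : 𝔽[X] →ₗ[𝔽] 𝔽) (S : L),
      HasSum (fun i => algebraMap 𝔽 L (l (X ^ i)) * w i) S →
      HasSum (fun i => algebraMap 𝔽 L (l (X * X ^ i)) * w i) (𝔠 X S) := by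
    intro l S hS
    have h := (hasSum_pow_card (𝔽 := 𝔽) hS).add (hS.mul_left θ)
    rw [← hc_X] at h
    have h' : HasSum (fun i => algebraMap 𝔽 L (l (X ^ i)) * if i = 0 then 0 else w (i - 1))
        (𝔠 X S) := by
      refine (hasSum_congr fun i => ?_).2 h
      rw [← hw, mul_pow, ← map_pow, FiniteField.pow_card]
      ring
    have h'' := (hasSum_nat_add_iff' 1).2 h'
    simpa [pow_succ'] using h''
  revert l S
  induction a using Polynomial.induction_on with
  | C s => exact fun l S => hC s l S
  | add f g hf hg =>
    intro l S hS
    rw [hc_add]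
    refine (hasSum_congr fun i => ?_).2 ((hf l hS).add (hg l hS))
    rw [add_mul, map_add, map_add, add_mul]
  | monomial n s ih =>
    rw [pow_succ, ← mul_assoc]
    exact fun l S => hmul _ _ (fun l S => ih l) hX l S

end AndersonThakur

lemma dvd_hasseDeriv_pow_mul {R : Type*} [CommRing R] (P : R[X]) (n : ℕ) :
    ∀ (m : ℕ) (g : R[X]), m < n → P ∣ hasseDeriv m (P ^ n * g) := by
  induction n with
  | zero => intro m g hm; omega
  | succ n ih =>
    intro m g hm
    rw [pow_succ', mul_assoc, hasseDeriv_mul]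
    refine Finset.dvd_sum fun ij hij => ?_
    have hij := Finset.HasAntidiagonal.mem_antidiagonal.1 hij
    rcases Nat.eq_zero_or_pos ij.1 with h0 | h0
    · rw [h0, hasseDeriv_zero']
      exact dvd_mul_right _ _
    · exact (ih ij.2 g (by omega)).mul_left _

/-- The `k`-th coordinate, in the basis of powers of `X`, of the residue modulo `P` of the `m`-th
Hasse derivative. -/
noncomputable def hasseResidueCoeff {R : Type*} [CommRing R] (P : R[X]) (m k : ℕ) :
    R[X] →ₗ[R] R :=
  lcoeff R k ∘ₗ P.modByMonicHom ∘ₗ hasseDeriv m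

section HasseResidueCoeff

variable {R S : Type*} [CommRing R] {P : R[X]}

lemma hasseResidueCoeff_apply (m k : ℕ) (f : R[X]) :
    hasseResidueCoeff P m k f = (hasseDeriv m f %ₘ P).coeff k := rfl

lemma hasseResidueCoeff_pow_mul (hP : P.Monic) {m n : ℕ} (hmn : m < n) (k : ℕ) (g : R[X]) :
    hasseResidueCoeff P m k (P ^ n * g) = 0 := by
  rw [hasseResidueCoeff_apply,
    (modByMonic_eq_zero_iff_dvd hP).2 (dvd_hasseDeriv_pow_mul P n m g hmn), coeff_zero]

lemma sum_hasseResidueCoeff [CommRing S] [Algebra R S] (hP : P.Monic) (hd : 0 < P.natDegree)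
    {z : S} (hz : aeval z P = 0) (m : ℕ) (f : R[X]) :
    ∑ k ∈ Finset.range P.natDegree, z ^ k * algebraMap R S (hasseResidueCoeff P m k f) =
      aeval z (hasseDeriv m f) := by
  rw [← aeval_modByMonic_eq_self_of_root hz,
    aeval_eq_sum_range' (natDegree_modByMonic_lt _ hP fun h => by simp [h] at hd)]
  refine Finset.sum_congr rfl fun k _ => ?_
  rw [hasseResidueCoeff_apply, Algebra.smul_def, mul_comm]

end HasseResidueCoeff

lemma hasSum_aeval_hasseDeriv {R S : Type*} [CommRing R] [CommRing S] [Algebra R S]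
    [TopologicalSpace S] [IsTopologicalRing S] {w : ℕ → S} {m : ℕ} {z Y : S}
    (h : HasSum (fun i : ℕ => ((i + m).choose m : S) * w (i + m) * z ^ i) Y) :
    HasSum (fun i => aeval z (hasseDeriv m (X ^ i : R[X])) * w i) Y := by
  have hX : ∀ i : ℕ, aeval z (hasseDeriv m (X ^ i : R[X])) = (i.choose m : S) * z ^ (i - m) := by
    intro i
    rw [← monomial_one_right_eq_X_pow, hasseDeriv_monomial, aeval_monomial]
    simp
  simp only [hX]
  have h' := (hasSum_nat_add_iff (f := fun i => (i.choose m : S) * z ^ (i - m) * w i) m).1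
    ((hasSum_congr fun i => by rw [Nat.add_sub_cancel]; ring).1 h)
  rwa [Finset.sum_eq_zero, add_zero] at h'
  intro i hi
  simp [Nat.choose_eq_zero_of_lt (Finset.mem_range.1 hi)]

lemma aeval_pow_card_pow {𝔽 S : Type*} [Field 𝔽] [Fintype 𝔽] [CommRing S] [Algebra 𝔽 S]
    {P : 𝔽[X]} {z : S} (hz : aeval z P = 0) (i : ℕ) :
    aeval (z ^ Fintype.card 𝔽 ^ i) P = 0 := by
  induction i with
  | zero => simpa
  | succ i ih =>
    have := aeval_algHom_apply (FiniteField.frobeniusAlgHom 𝔽 S) (z ^ Fintype.card 𝔽 ^ i) P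
    rwa [ih, map_zero, FiniteField.frobeniusAlgHom_apply, ← pow_mul, ← pow_succ] at this

section MapOn

variable {L : Type*} [Field L] {E : Subfield L} {σ : L → L}

lemma map_pow_of_map_mul_on (hmul : ∀ x ∈ E, ∀ y ∈ E, σ (x * y) = σ x * σ y) (h1 : σ 1 = 1)
    {x : L} (hx : x ∈ E) (k : ℕ) : σ (x ^ k) = σ x ^ k := by
  induction k with
  | zero => simpa
  | succ k ih => rw [pow_succ, hmul _ (pow_mem hx k) _ hx, ih, pow_succ]

lemma map_sum_pow_mul (hadd : ∀ x ∈ E, ∀ y ∈ E, σ (x + y) = σ x + σ y)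
    (hmul : ∀ x ∈ E, ∀ y ∈ E, σ (x * y) = σ x * σ y)
    (h1 : σ 1 = 1) {x : L} (hx : x ∈ E) {b : ℕ → L} (hb : ∀ k, b k ∈ E) (d : ℕ) :
    σ (∑ k ∈ Finset.range d, x ^ k * b k) = ∑ k ∈ Finset.range d, σ x ^ k * σ (b k) := by
  induction d with
  | zero => simpa using hadd 0 E.zero_mem 0 E.zero_mem
  | succ d ih =>
    rw [Finset.sum_range_succ, Finset.sum_range_succ, hadd _ _ _ _, ih,
      hmul _ (pow_mem hx d) _ (hb d), map_pow_of_map_mul_on hmul h1 hx]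
    · exact sum_mem fun k _ => mul_mem (pow_mem hx k) (hb k)
    · exact mul_mem (pow_mem hx d) (hb d)

end MapOn

/-- Galois action on `ω^{(n)}(ζ)`.
In the Carlitz/Anderson–Thakur setting, fix `n ≥ 0`.  Then `ω^{(m)}(ζ) ∈ K_n(ζ)` for
every `0 ≤ m ≤ n`.  Moreover:
(a) if `a ∈ A` is coprime to `𝔭` and `σ` is a field automorphism of `K_n(ζ)` fixing
`K(ζ)` pointwise with `σ(x) = 𝔠_a(x)` for every `x ∈ C[𝔭^{n+1}]`, then
`σ(ω^{(n)}(ζ)) = ∑_{j=0}^n a_t^{(j)}(ζ) · ω^{(n-j)}(ζ)`;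
(b) if `F` is a field automorphism of `K_n(ζ)` fixing `K` and `C[𝔭^{n+1}]` pointwise
with `F(ζ) = ζ^q`, then `F(ω^{(n)}(ζ_i)) = ω^{(n)}(ζ_{i+1})` for all `i = 1, …, d-1`. -/
theorem stmt_8 {L : Type*} [NormedField L] [CompleteSpace L] [IsAlgClosed L]
    (hna : IsNonarchimedean (fun x : L => ‖x‖))
    (p q κ : ℕ) (hp : p.Prime) (hκ : 0 < κ) (hq : q = p ^ κ)
    (𝔽 : Type*) [Field 𝔽] [Fintype 𝔽] [Algebra 𝔽 L] (hcard : Fintype.card 𝔽 = q)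
    (θ : L) (hθ : ‖θ‖ = q)
    (𝔠 : Polynomial 𝔽 → L → L)
    (hc_add : ∀ a b : Polynomial 𝔽, ∀ x : L, 𝔠 (a + b) x = 𝔠 a x + 𝔠 b x)
    (hc_mul : ∀ a b : Polynomial 𝔽, ∀ x : L, 𝔠 (a * b) x = 𝔠 a (𝔠 b x))
    (hc_C : ∀ (s : 𝔽) (x : L), 𝔠 (Polynomial.C s) x = algebraMap 𝔽 L s * x)
    (hc_X : ∀ x : L, 𝔠 Polynomial.X x = x ^ q + θ * x)
    (hc_lin : ∀ (a : Polynomial 𝔽) (x y : L), 𝔠 a (x + y) = 𝔠 a x + 𝔠 a y)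
    (hc_smul : ∀ (a : Polynomial 𝔽) (s : 𝔽) (x : L),
      𝔠 a (algebraMap 𝔽 L s * x) = algebraMap 𝔽 L s * 𝔠 a x)
    (lamθ : L) (hlamθ : lamθ ^ (q - 1) = -θ)
    (w : ℕ → L) (hw0 : Filter.Tendsto (fun i => ‖w i‖) Filter.atTop (nhds 0))
    (hωdef : ∀ z : L, ‖z‖ ≤ 1 → ∃ P : L,
      HasProd (fun j : ℕ => (1 - z / θ ^ q ^ j)⁻¹) P ∧
      HasSum (fun i : ℕ => w i * z ^ i) (lamθ * P))
    (Ω : ℕ → L → L)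
    (hΩ : ∀ (n : ℕ) (z : L), ‖z‖ ≤ 1 →
      HasSum (fun i : ℕ => ((i + n).choose n : L) * w (i + n) * z ^ i) (Ω n z))
    (d : ℕ) (hd : 0 < d)
    (𝔭 : Polynomial 𝔽) (hmonic : 𝔭.Monic) (hirr : Irreducible 𝔭)
    (hdeg : 𝔭.natDegree = d)
    (ζ : L) (hζ : Polynomial.aeval ζ 𝔭 = 0)
    (n : ℕ) :
    let K : Subfield L := Subfield.closure (Set.range (algebraMap 𝔽 L) ∪ {θ})
    let Kζ : Subfield L := Subfield.closure (Set.range (algebraMap 𝔽 L) ∪ {θ, ζ})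
    let Knζ : Subfield L := Subfield.closure
      (Set.range (algebraMap 𝔽 L) ∪ {θ, ζ} ∪ {y : L | 𝔠 (𝔭 ^ (n + 1)) y = 0})
    (∀ m ≤ n, Ω m ζ ∈ Knζ) ∧
    (∀ a : Polynomial 𝔽, IsCoprime a 𝔭 → ∀ σ : L → L,
      (∀ x ∈ Knζ, ∀ y ∈ Knζ, σ (x + y) = σ x + σ y) →
      (∀ x ∈ Knζ, ∀ y ∈ Knζ, σ (x * y) = σ x * σ y) →
      Set.BijOn σ Knζ Knζ →
      (∀ x ∈ Kζ, σ x = x) →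
      (∀ x : L, 𝔠 (𝔭 ^ (n + 1)) x = 0 → σ x = 𝔠 a x) →
      σ (Ω n ζ) = ∑ j ∈ Finset.range (n + 1),
        Polynomial.aeval ζ (Polynomial.hasseDeriv j a) * Ω (n - j) ζ) ∧
    (∀ F : L → L,
      (∀ x ∈ Knζ, ∀ y ∈ Knζ, F (x + y) = F x + F y) →
      (∀ x ∈ Knζ, ∀ y ∈ Knζ, F (x * y) = F x * F y) →
      Set.BijOn F Knζ Knζ →
      (∀ x ∈ K, F x = x) →
      (∀ x : L, 𝔠 (𝔭 ^ (n + 1)) x = 0 → F x = x) →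
      F ζ = ζ ^ q →
      ∀ i : ℕ, 1 ≤ i → i ≤ d - 1 →
        F (Ω n (ζ ^ q ^ (i - 1))) = Ω n (ζ ^ q ^ i)) := by
  intro K Kζ Knζ
  have := IsUltrametricDist.isUltrametricDist_of_isNonarchimedean_norm hna
  subst hdeg hcard
  have hθ1 : 1 < ‖θ‖ := by
    rw [hθ]
    exact_mod_cast Fintype.one_lt_card
  have hw := andersonThakur_coeff hθ1 hlamθ hωdef
  choose B hB using fun m k => summable_algebraMap_mul (L := L) hw0
    fun i => hasseResidueCoeff 𝔭 m k (X ^ i)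
  have hcarlitz : ∀ (a : 𝔽[X]) (m k : ℕ),
      HasSum (fun i => algebraMap 𝔽 L (hasseResidueCoeff 𝔭 m k (a * X ^ i)) * w i)
        (𝔠 a (B m k)) := fun a m k =>
    hasSum_carlitz hc_add hc_mul hc_C hc_X hw a _ (hB m k)
  have htors : ∀ m ≤ n, ∀ k, 𝔠 (𝔭 ^ (n + 1)) (B m k) = 0 := by
    intro m hm k
    have h := hcarlitz (𝔭 ^ (n + 1)) m k
    simp only [hasseResidueCoeff_pow_mul hmonic (Nat.lt_succ_of_le hm), map_zero, zero_mul] at h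
    exact h.unique hasSum_zero
  have hroot : ∀ z : L, aeval z 𝔭 = 0 → ‖z‖ ≤ 1 := fun z hz =>
    norm_le_one_of_isAlgebraic_finite (𝔽 := 𝔽) ⟨𝔭, hmonic.ne_zero, hz⟩
  have hsum : ∀ z : L, aeval z 𝔭 = 0 → ∀ (a : 𝔽[X]) (m : ℕ),
      HasSum (fun i => aeval z (hasseDeriv m (a * X ^ i)) * w i)
        (∑ k ∈ Finset.range 𝔭.natDegree, z ^ k * 𝔠 a (B m k)) := by
    intro z hz a m
    refine (hasSum_congr fun i => ?_).1 (hasSum_sum fun k (_ : k ∈ Finset.range 𝔭.natDegree) =>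
      (hcarlitz a m k).mul_left (z ^ k))
    rw [← sum_hasseResidueCoeff hmonic hd hz, Finset.sum_mul]
    exact Finset.sum_congr rfl fun k _ => (mul_assoc _ _ _).symm
  have hΩ' : ∀ z : L, aeval z 𝔭 = 0 → ∀ m,
      HasSum (fun i => aeval z (hasseDeriv m (X ^ i : 𝔽[X])) * w i) (Ω m z) :=
    fun z hz m => hasSum_aeval_hasseDeriv (hΩ m z (hroot z hz))
  have hc_one : ∀ x, 𝔠 1 x = x := fun x => by rw [← C_1, hc_C, map_one, one_mul]
  have hΩB : ∀ z : L, aeval z 𝔭 = 0 → ∀ m,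
      Ω m z = ∑ k ∈ Finset.range 𝔭.natDegree, z ^ k * B m k := by
    intro z hz m
    have h := hsum z hz 1 m
    simp only [one_mul, hc_one] at h
    exact (hΩ' z hz m).unique h
  have hζmem : ζ ∈ Knζ := Subfield.subset_closure (Or.inl (Or.inr (Or.inr rfl)))
  have hBmem : ∀ m ≤ n, ∀ k, B m k ∈ Knζ := fun m hm k =>
    Subfield.subset_closure (Or.inr (htors m hm k))
  refine ⟨fun m hm => ?_, fun a _ σ hadd hmul _ hfix htor => ?_,
    fun F hadd hmul _ hfix htor hFζ i hi _ => ?_⟩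
  · rw [hΩB ζ hζ]
    exact sum_mem fun k _ => mul_mem (pow_mem hζmem k) (hBmem m hm k)
  · rw [hΩB ζ hζ, map_sum_pow_mul hadd hmul (hfix 1 (one_mem _)) hζmem (hBmem n le_rfl),
      hfix ζ (Subfield.subset_closure (Or.inr (Or.inr rfl)))]
    simp only [htor _ (htors n le_rfl _)]
    refine (hsum ζ hζ a n).unique ?_
    refine (hasSum_congr fun i => ?_).2 (hasSum_sum fun j (_ : j ∈ Finset.range (n + 1)) =>
      (hΩ' ζ hζ (n - j)).mul_left (aeval ζ (hasseDeriv j a)))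
    rw [hasseDeriv_mul, Finset.Nat.sum_antidiagonal_eq_sum_range_succ
      (fun i' j' => hasseDeriv i' a * hasseDeriv j' (X ^ i)), map_sum, Finset.sum_mul]
    exact Finset.sum_congr rfl fun j _ => by rw [map_mul, mul_assoc]
  · have h1 := hfix 1 (one_mem _)
    rw [hΩB _ (aeval_pow_card_pow hζ _), hΩB _ (aeval_pow_card_pow hζ _),
      map_sum_pow_mul hadd hmul h1 (pow_mem hζmem _) (hBmem n le_rfl),
      map_pow_of_map_mul_on hmul h1 hζmem, hFζ, ← pow_mul, mul_comm, ← pow_succ,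
      Nat.sub_add_cancel hi]
    simp only [htor _ (htors n le_rfl _)]
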